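/- arXiv:1402.3969 — 2 statements merged into one kernel-verified Lean document; each statement's English description precedes it below -/
import Mathlib

section
/- If m, n ∈ ℕ, A ⊆ G ⊆ 2^{[m]}, B ⊆ H ⊆ 2^{[n]}, G and H are hereditary and compressed, and A and B are cross-intersecting, then |A|·|B| ≤ |G(1)|·|H(1)|, where G(1) = {S ∈ G : 1 ∈ S} and H(1) = {S ∈ H : 1 ∈ S}. -/
open Finset

/-- `𝒢` is a family of subsets of `{1, …, n}` that is hereditary and compressed. -/
structure IsCompressedComplex (n : ℕ) (𝒢 : Finset (Finset ℕ)) : Prop where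
  subset_Icc : ∀ S ∈ 𝒢, S ⊆ Icc 1 n
  mem_of_subset : ∀ S ∈ 𝒢, ∀ T ⊆ S, T ∈ 𝒢
  shift_mem : ∀ i j, 1 ≤ i → i < j → ∀ S ∈ 𝒢, j ∈ S → i ∉ S → insert i (S.erase j) ∈ 𝒢

/-- Every set of `𝒜` meets every set of `ℬ`. -/
def CrossIntersecting (𝒜 ℬ : Finset (Finset ℕ)) : Prop :=
  ∀ A ∈ 𝒜, ∀ B ∈ ℬ, (A ∩ B).Nonempty

/-- The number of members of `𝒢` that contain `1`. -/
def starCard (𝒢 : Finset (Finset ℕ)) : ℕ := #{S ∈ 𝒢 | 1 ∈ S}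

/-- A single-element compression changes a member `S` of the family only by replacing `j` by `i`,
and only when the result is new. -/
theorem mem_compression_singleton {i j : ℕ} {𝒜 : Finset (Finset ℕ)} {A : Finset ℕ}
    (hij : i ≠ j) :
    A ∈ UV.compression {i} {j} 𝒜 ↔
      (A ∈ 𝒜 ∧ (j ∈ A → i ∉ A → insert i (A.erase j) ∈ 𝒜)) ∨
        (A ∉ 𝒜 ∧ i ∈ A ∧ j ∉ A ∧ insert j (A.erase i) ∈ 𝒜) := by
  have key : ∀ B : Finset ℕ, j ∈ B → i ∉ B → (B ⊔ {i}) \ {j} = insert i (B.erase j) := by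
    intro B hj hi
    ext x
    simp only [sup_eq_union, mem_sdiff, mem_union, mem_singleton, mem_insert, mem_erase]
    grind
  rw [UV.mem_compression]
  refine or_congr ?_ ?_
  · refine and_congr_right fun hA => ?_
    unfold UV.compress
    simp only [disjoint_singleton_left, singleton_subset_iff]
    split_ifs with h
    · rw [key A h.2 h.1]
      simp [h.1, h.2]
    · exact ⟨fun _ hj hi => absurd ⟨hi, hj⟩ h, fun _ => hA⟩
  · refine and_congr_right fun hA => ?_
    unfold UV.compress
    simp only [disjoint_singleton_left, singleton_subset_iff]
    constructor
    · rintro ⟨B, hB, h⟩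
      split_ifs at h with hc
      · rw [key B hc.2 hc.1] at h
        subst h
        refine ⟨mem_insert_self _ _, by simp [hij.symm], ?_⟩
        rwa [erase_insert (by simp [hc.1]), insert_erase hc.2]
      · exact absurd (h ▸ hB) hA
    · rintro ⟨hi, hj, h⟩
      refine ⟨_, h, ?_⟩
      have h1 : i ∉ insert j (A.erase i) := by simp [hij]
      rw [if_pos ⟨h1, mem_insert_self _ _⟩, key _ (mem_insert_self _ _) h1,
        erase_insert (by simp [hj]), insert_erase hi]

theorem CrossIntersecting.symm {𝒜 ℬ : Finset (Finset ℕ)} (h : CrossIntersecting 𝒜 ℬ) :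
    CrossIntersecting ℬ 𝒜 := fun B hB A hA => inter_comm A B ▸ h A hA B hB

theorem inter_nonempty_of_compressed_left {i j : ℕ} (hij : i ≠ j)
    {𝒜 ℬ : Finset (Finset ℕ)} (h : CrossIntersecting 𝒜 ℬ) {A B : Finset ℕ}
    (hi : i ∈ A) (hA : insert j (A.erase i) ∈ 𝒜) (hB : B ∈ ℬ)
    (hB' : j ∈ B → i ∉ B → insert i (B.erase j) ∈ ℬ) : (A ∩ B).Nonempty := by
  by_cases hiB : i ∈ B
  · exact ⟨i, mem_inter.2 ⟨hi, hiB⟩⟩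
  by_cases hjB : j ∈ B
  · obtain ⟨x, hx⟩ := h _ hA _ (hB' hjB hiB)
    exact ⟨x, by grind⟩
  · obtain ⟨x, hx⟩ := h _ hA _ hB
    exact ⟨x, by grind⟩

theorem CrossIntersecting.compression {i j : ℕ} (hij : i ≠ j) {𝒜 ℬ : Finset (Finset ℕ)}
    (h : CrossIntersecting 𝒜 ℬ) :
    CrossIntersecting (UV.compression {i} {j} 𝒜) (UV.compression {i} {j} ℬ) := by
  intro A hA B hB
  rw [mem_compression_singleton hij] at hA hB
  rcases hA with ⟨hA, hA'⟩ | ⟨-, hiA, -, hA⟩ <;> rcases hB with ⟨hB, hB'⟩ | ⟨-, hiB, -, hB⟩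
  · exact h A hA B hB
  · rw [inter_comm]
    exact inter_nonempty_of_compressed_left hij h.symm hiB hB hA hA'
  · exact inter_nonempty_of_compressed_left hij h hiA hA hB hB'
  · exact ⟨i, mem_inter.2 ⟨hiA, hiB⟩⟩

theorem IsCompressedComplex.compression_subset {n i j : ℕ} (hi : 1 ≤ i) (hij : i < j)
    {𝒜 𝒢 : Finset (Finset ℕ)} (h𝒢 : IsCompressedComplex n 𝒢) (h : 𝒜 ⊆ 𝒢) :
    UV.compression {i} {j} 𝒜 ⊆ 𝒢 := by
  intro A hA
  rw [mem_compression_singleton hij.ne] at hA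
  rcases hA with ⟨hA, -⟩ | ⟨-, hiA, hjA, hA⟩
  · exact h hA
  · have := h𝒢.shift_mem i j hi hij _ (h hA) (mem_insert_self _ _) (by simp [hij.ne])
    rwa [erase_insert (by simp [hjA]), insert_erase hiA] at this

/-- Compressing a family that is not yet compressed lowers the degree of `j`. -/
theorem card_filter_compression_lt {i j : ℕ} (hij : i ≠ j) {𝒜 : Finset (Finset ℕ)} {S : Finset ℕ}
    (hS : S ∈ 𝒜) (hj : j ∈ S) (hi : i ∉ S) (h : insert i (S.erase j) ∉ 𝒜) :
    #{A ∈ UV.compression {i} {j} 𝒜 | j ∈ A} < #{A ∈ 𝒜 | j ∈ A} := by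
  refine card_lt_card ((ssubset_iff_of_subset ?_).2 ⟨S, by simp [hS, hj], ?_⟩)
  · intro A hA
    rw [mem_filter, mem_compression_singleton hij] at hA
    grind
  · rw [mem_filter, mem_compression_singleton hij]
    grind

namespace IsCompressedComplex

variable {n : ℕ} {𝒢 : Finset (Finset ℕ)}

theorem nonMemberSubfamily (h : IsCompressedComplex (n + 1) 𝒢) :
    IsCompressedComplex n (𝒢.nonMemberSubfamily (n + 1)) where
  subset_Icc S hS x hx := by
    rw [mem_nonMemberSubfamily] at hS
    have := h.subset_Icc S hS.1 hx
    have : x ≠ n + 1 := fun e => hS.2 (e ▸ hx)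
    grind
  mem_of_subset S hS T hT := by
    rw [mem_nonMemberSubfamily] at hS ⊢
    exact ⟨h.mem_of_subset S hS.1 T hT, fun hx => hS.2 (hT hx)⟩
  shift_mem i j hi hij S hS hj hiS := by
    rw [mem_nonMemberSubfamily] at hS ⊢
    have := h.subset_Icc S hS.1 hj
    exact ⟨h.shift_mem i j hi hij S hS.1 hj hiS, by grind⟩

theorem memberSubfamily (h : IsCompressedComplex (n + 1) 𝒢) :
    IsCompressedComplex n (𝒢.memberSubfamily (n + 1)) where
  subset_Icc S hS x hx := by
    rw [mem_memberSubfamily] at hS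
    have := h.subset_Icc _ hS.1 (mem_insert_of_mem hx)
    have : x ≠ n + 1 := fun e => hS.2 (e ▸ hx)
    grind
  mem_of_subset S hS T hT := by
    rw [mem_memberSubfamily] at hS ⊢
    exact ⟨h.mem_of_subset _ hS.1 _ (insert_subset_insert _ hT), fun hx => hS.2 (hT hx)⟩
  shift_mem i j hi hij S hS hj hiS := by
    rw [mem_memberSubfamily] at hS ⊢
    have hjn := h.subset_Icc _ hS.1 (mem_insert_of_mem hj)
    have hne : j ≠ n + 1 := fun e => hS.2 (e ▸ hj)
    have hin : i ≠ n + 1 := by grind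
    have := h.shift_mem i j hi hij _ hS.1 (mem_insert_of_mem hj) (by grind)
    rw [erase_insert_of_ne hne.symm, insert_comm] at this
    exact ⟨this, by grind⟩

theorem memberSubfamily_subset (h : IsCompressedComplex n 𝒢) (a : ℕ) :
    𝒢.memberSubfamily a ⊆ 𝒢.nonMemberSubfamily a := by
  intro S hS
  rw [mem_memberSubfamily] at hS
  exact mem_nonMemberSubfamily.2 ⟨h.mem_of_subset _ hS.1 _ (subset_insert _ _), hS.2⟩

theorem singleton_one_mem (h : IsCompressedComplex n 𝒢) {S : Finset ℕ} (hS : S ∈ 𝒢)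
    (hne : S.Nonempty) : {1} ∈ 𝒢 := by
  obtain ⟨x, hx⟩ := hne
  have hxG : {x} ∈ 𝒢 := h.mem_of_subset S hS _ (singleton_subset_iff.2 hx)
  have hx1 := h.subset_Icc S hS hx
  rw [mem_Icc] at hx1
  rcases hx1.1.eq_or_lt with rfl | hlt
  · exact hxG
  · simpa using h.shift_mem 1 x le_rfl hlt _ hxG (mem_singleton_self x) (by simpa using hlt.ne)

theorem eq_powerset (hn : 1 ≤ n) (h : IsCompressedComplex (n + 1) 𝒢) (h1 : {1} ∈ 𝒢)
    (hcard : starCard (𝒢.memberSubfamily (n + 1)) = starCard (𝒢.nonMemberSubfamily (n + 1))) :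
    𝒢 = (Icc 1 (n + 1)).powerset := by
  have heq := eq_of_subset_of_card_le
    (filter_subset_filter (fun S : Finset ℕ => 1 ∈ S) (h.memberSubfamily_subset (n + 1))) hcard.ge
  have hext : ∀ S ∈ 𝒢, 1 ∈ S → n + 1 ∉ S → insert (n + 1) S ∈ 𝒢 := by
    intro S hS h1S hnS
    have hmem : S ∈ {S ∈ 𝒢.memberSubfamily (n + 1) | 1 ∈ S} := by
      rw [heq]
      simp [hS, h1S, hnS]
    exact (mem_memberSubfamily.1 (mem_filter.1 hmem).1).1
  obtain ⟨S, hS, hmax⟩ := exists_max_image {S ∈ 𝒢 | 1 ∈ S} card ⟨{1}, by simp [h1]⟩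
  rw [mem_filter] at hS
  have hgrow : ∀ x, x ∉ S → insert x S ∉ 𝒢 := by
    intro x hx hxG
    have := hmax (insert x S) (by simp [hxG, hS.2])
    rw [card_insert_of_notMem hx] at this
    omega
  have hnS : n + 1 ∈ S := by
    by_contra hnS
    exact hgrow _ hnS (hext S hS.1 hS.2 hnS)
  have hfull : Icc 1 (n + 1) ⊆ S := by
    intro x hx
    by_contra hxS
    have hxn : x ≠ n + 1 := fun e => hxS (e ▸ hnS)
    rw [mem_Icc] at hx
    have hsh := h.shift_mem x (n + 1) hx.1 (by omega) S hS.1 hnS hxS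
    have := hext _ hsh (by grind) (by grind)
    rw [insert_comm, insert_erase hnS] at this
    exact hgrow x hxS this
  ext T
  rw [mem_powerset]
  exact ⟨h.subset_Icc T, fun hT => h.mem_of_subset S hS.1 T (hT.trans hfull)⟩

end IsCompressedComplex

theorem starCard_split {a : ℕ} (ha : a ≠ 1) (𝒢 : Finset (Finset ℕ)) :
    starCard 𝒢 = starCard (𝒢.nonMemberSubfamily a) + starCard (𝒢.memberSubfamily a) := by
  unfold starCard
  rw [← card_memberSubfamily_add_card_nonMemberSubfamily a {S ∈ 𝒢 | 1 ∈ S}, add_comm]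
  congr 2 <;> ext S <;> simp [ha.symm] <;> tauto

theorem two_pow_le_starCard_powerset (n : ℕ) : 2 ^ n ≤ starCard (Icc 1 (n + 1)).powerset := by
  have hinj : Set.InjOn (insert 1) ((Icc 2 (n + 1)).powerset : Set (Finset ℕ)) := by
    intro S hS T hT hST
    have hS1 : 1 ∉ S := fun h => by simpa using mem_powerset.1 hS h
    have hT1 : 1 ∉ T := fun h => by simpa using mem_powerset.1 hT h
    rw [← erase_insert hS1, ← erase_insert hT1, hST]
  calc 2 ^ n = #((Icc 2 (n + 1)).powerset.image (insert 1)) := by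
        rw [card_image_of_injOn hinj, card_powerset, Nat.card_Icc]
        rfl
    _ ≤ _ := by
        refine card_le_card fun S hS => ?_
        obtain ⟨T, hT, rfl⟩ := mem_image.1 hS
        rw [mem_filter, mem_powerset]
        refine ⟨fun x hx => ?_, mem_insert_self _ _⟩
        have hTx : x ∈ T → x ∈ Icc 2 (n + 1) := fun h => mem_powerset.1 hT h
        grind

/-- A set and its complement cannot belong to two cross-intersecting families respectively. -/
theorem CrossIntersecting.card_add_card_le {X : Finset ℕ} {𝒜 ℬ : Finset (Finset ℕ)}
    (h𝒜 : 𝒜 ⊆ X.powerset) (hℬ : ℬ ⊆ X.powerset) (h : CrossIntersecting 𝒜 ℬ) :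
    #𝒜 + #ℬ ≤ 2 ^ #X := by
  have hinj : Set.InjOn (X \ ·) (ℬ : Set (Finset ℕ)) := by
    intro S hS T hT hST
    have hS' := mem_powerset.1 (hℬ hS)
    have hT' := mem_powerset.1 (hℬ hT)
    rw [← Finset.sdiff_sdiff_eq_self hS', ← Finset.sdiff_sdiff_eq_self hT']
    exact congrArg (X \ ·) hST
  have hdisj : Disjoint 𝒜 (ℬ.image (X \ ·)) := by
    rw [disjoint_left]
    intro A hA hA'
    obtain ⟨B, hB, rfl⟩ := mem_image.1 hA'
    obtain ⟨x, hx⟩ := h _ hA B hB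
    grind
  rw [← card_image_of_injOn hinj, ← card_union_of_disjoint hdisj, ← card_powerset]
  refine card_le_card (union_subset h𝒜 fun S hS => ?_)
  obtain ⟨B, -, rfl⟩ := mem_image.1 hS
  exact mem_powerset.2 sdiff_subset

/-- The numerical core of the induction step: redistributing `k` conflicting pairs as evenly as
possible loses at most one, and then only if all four bounds are equal. -/
theorem mul_le_mul_or_eq_of_redistribute {a₀ a₁ b₀ b₁ g₀ g₁ h₀ h₁ k : ℕ} (hka : k ≤ a₁)
    (hkb : k ≤ b₁)
    (h : ∀ x y, x + y = k → (a₀ + x) * (b₀ + y) ≤ g₀ * h₀ ∧ (a₀ + x) * (b₁ - x) ≤ g₀ * h₁ ∧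
      (a₁ - y) * (b₀ + y) ≤ g₁ * h₀ ∧ (a₁ - y) * (b₁ - x) ≤ g₁ * h₁) :
    (a₀ + a₁) * (b₀ + b₁) ≤ (g₀ + g₁) * (h₀ + h₁) ∨
      (g₀ * h₀ = g₀ * h₁ ∧ g₀ * h₀ = g₁ * h₀) := by
  obtain ⟨c, rfl⟩ := Nat.exists_eq_add_of_le hka
  obtain ⟨d, rfl⟩ := Nat.exists_eq_add_of_le hkb
  have hsub : ∀ x y, x + y = k → (a₀ + x) * (b₀ + y) ≤ g₀ * h₀ ∧
      (a₀ + x) * (y + d) ≤ g₀ * h₁ ∧ (x + c) * (b₀ + y) ≤ g₁ * h₀ ∧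
      (x + c) * (y + d) ≤ g₁ * h₁ := by
    intro x y hxy
    have := h x y hxy
    rwa [show k + c - y = x + c by omega, show k + d - x = y + d by omega] at this
  obtain ⟨y, rfl | rfl⟩ := Nat.even_or_odd' k
  · left
    obtain ⟨e₁, e₂, e₃, e₄⟩ := hsub y y (by ring)
    linarith
  · obtain ⟨e₁, e₂, e₃, e₄⟩ := hsub (y + 1) y (by ring)
    obtain ⟨f₁, f₂, f₃, f₄⟩ := hsub y (y + 1) (by ring)
    rw [or_iff_not_imp_left, not_le]
    intro hlt
    have hab : a₀ + c = b₀ + d := by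
      rcases lt_trichotomy (a₀ + c) (b₀ + d) with hl | he | hl
      · linarith
      · exact he
      · linarith
    have E₁ : (a₀ + (y + 1)) * (b₀ + y) = g₀ * h₀ := by linarith
    have E₂ : (a₀ + (y + 1)) * (y + d) = g₀ * h₁ := by linarith
    have E₃ : (y + 1 + c) * (b₀ + y) = g₁ * h₀ := by linarith
    have F₁ : (a₀ + y) * (b₀ + (y + 1)) = g₀ * h₀ := by linarith
    have F₂ : (a₀ + y) * (y + 1 + d) = g₀ * h₁ := by linarith
    have F₃ : (y + c) * (b₀ + (y + 1)) = g₁ * h₀ := by linarith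
    have h₁ : a₀ = b₀ := by linarith
    have h₂ : a₀ = d := by linarith
    have h₃ : b₀ = c := by linarith
    subst h₁ h₂ h₃
    constructor <;> linarith

/-- If the only disjoint pairs in `𝒜₁ × ℬ₁` are complementary ones, then each such pair can be
resolved by moving one of its two sets from the second layer to the first. -/
theorem exists_redistribution {X : Finset ℕ} {𝒜₀ 𝒜₁ ℬ₀ ℬ₁ : Finset (Finset ℕ)}
    (h𝒜₁ : 𝒜₁ ⊆ X.powerset) (h₀₀ : CrossIntersecting 𝒜₀ ℬ₀) (h₀₁ : CrossIntersecting 𝒜₀ ℬ₁)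
    (h₁₀ : CrossIntersecting 𝒜₁ ℬ₀)
    (h₁₁ : ∀ A ∈ 𝒜₁, ∀ B ∈ ℬ₁, (A ∩ B).Nonempty ∨ B = X \ A) :
    ∃ k, k ≤ #𝒜₁ ∧ k ≤ #ℬ₁ ∧ ∀ x y, x + y = k → ∃ 𝒜₀' ⊆ 𝒜₀ ∪ 𝒜₁, ∃ 𝒜₁' ⊆ 𝒜₁,
      ∃ ℬ₀' ⊆ ℬ₀ ∪ ℬ₁, ∃ ℬ₁' ⊆ ℬ₁,
        (#𝒜₀' = #𝒜₀ + x ∧ #𝒜₁' = #𝒜₁ - y ∧ #ℬ₀' = #ℬ₀ + y ∧ #ℬ₁' = #ℬ₁ - x) ∧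
        CrossIntersecting 𝒜₀' ℬ₀' ∧ CrossIntersecting 𝒜₀' ℬ₁' ∧
        CrossIntersecting 𝒜₁' ℬ₀' ∧ CrossIntersecting 𝒜₁' ℬ₁' := by
  set K : Finset (Finset ℕ) := {A ∈ 𝒜₁ | X \ A ∈ ℬ₁} with hK
  have hK₁ : K ⊆ 𝒜₁ := filter_subset _ _
  have hinj : Set.InjOn (X \ ·) (K : Set (Finset ℕ)) := by
    intro S hS T hT hST
    have hS' := mem_powerset.1 (h𝒜₁ (hK₁ hS))
    have hT' := mem_powerset.1 (h𝒜₁ (hK₁ hT))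
    rw [← Finset.sdiff_sdiff_eq_self hS', ← Finset.sdiff_sdiff_eq_self hT']
    exact congrArg (X \ ·) hST
  have hKℬ : K.image (X \ ·) ⊆ ℬ₁ := by
    intro B hB
    obtain ⟨A, hA, rfl⟩ := mem_image.1 hB
    exact (mem_filter.1 hA).2
  refine ⟨#K, card_le_card hK₁, ?_, ?_⟩
  · rw [← card_image_of_injOn hinj]
    exact card_le_card hKℬ
  intro x y hxy
  obtain ⟨T, hTK, rfl⟩ := exists_subset_card_eq (show x ≤ #K by omega)
  obtain rfl : y = #(K \ T) := by rw [card_sdiff_of_subset hTK]; omega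
  have hUK : K \ T ⊆ K := sdiff_subset
  have himT : T.image (X \ ·) ⊆ ℬ₁ := (image_subset_image hTK).trans hKℬ
  have himU : (K \ T).image (X \ ·) ⊆ ℬ₁ := (image_subset_image hUK).trans hKℬ
  have hcT : #(T.image (X \ ·)) = #T := card_image_of_injOn (hinj.mono (by exact_mod_cast hTK))
  have hcU : #((K \ T).image (X \ ·)) = #(K \ T) :=
    card_image_of_injOn (hinj.mono (by exact_mod_cast hUK))
  refine ⟨𝒜₀ ∪ T, union_subset_union_right (hTK.trans hK₁), 𝒜₁ \ (K \ T), sdiff_subset,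
    ℬ₀ ∪ (K \ T).image (X \ ·), union_subset_union_right himU, ℬ₁ \ T.image (X \ ·),
    sdiff_subset, ⟨?_, card_sdiff_of_subset (hUK.trans hK₁), ?_, ?_⟩, ?_, ?_, ?_, ?_⟩
  · refine card_union_of_disjoint (disjoint_left.2 fun A hA hA' => ?_)
    obtain ⟨z, hz⟩ := h₀₁ A hA _ (mem_filter.1 (hTK hA')).2
    grind
  · rw [← hcU]
    refine card_union_of_disjoint (disjoint_left.2 fun B hB hB' => ?_)
    obtain ⟨A, hA, rfl⟩ := mem_image.1 hB'
    obtain ⟨z, hz⟩ := h₁₀ A (hK₁ (hUK hA)) _ hB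
    grind
  · rw [card_sdiff_of_subset himT, hcT]
  · intro A hA B hB
    rcases mem_union.1 hA with hA | hA <;> rcases mem_union.1 hB with hB | hB
    · exact h₀₀ A hA B hB
    · exact h₀₁ A hA B (himU hB)
    · exact h₁₀ A (hK₁ (hTK hA)) B hB
    · refine (h₁₁ A (hK₁ (hTK hA)) B (himU hB)).resolve_right ?_
      rintro rfl
      obtain ⟨C, hC, hCA⟩ := mem_image.1 hB
      obtain rfl := hinj (hUK hC) (hTK hA) hCA
      exact (mem_sdiff.1 hC).2 hA
  · intro A hA B hB
    rw [mem_sdiff] at hB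
    rcases mem_union.1 hA with hA | hA
    · exact h₀₁ A hA B hB.1
    · refine (h₁₁ A (hK₁ (hTK hA)) B hB.1).resolve_right ?_
      rintro rfl
      exact hB.2 (mem_image_of_mem _ hA)
  · intro A hA B hB
    rw [mem_sdiff] at hA
    rcases mem_union.1 hB with hB | hB
    · exact h₁₀ A hA.1 B hB
    · refine (h₁₁ A hA.1 B (himU hB)).resolve_right ?_
      rintro rfl
      obtain ⟨C, hC, hCA⟩ := mem_image.1 hB
      obtain rfl := hinj (hUK hC) (mem_filter.2 ⟨hA.1, himU hB⟩) hCA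
      exact hA.2 hC
  · intro A hA B hB
    rw [mem_sdiff] at hA hB
    refine (h₁₁ A hA.1 B hB.1).resolve_right ?_
    rintro rfl
    have hAK : A ∈ K := mem_filter.2 ⟨hA.1, hB.1⟩
    by_cases hAT : A ∈ T
    · exact hB.2 (mem_image_of_mem _ hAT)
    · exact hA.2 (mem_sdiff.2 ⟨hAK, hAT⟩)

/-- If `𝒜` is compressed towards every `i ≤ n` from `n + 1`, then links at `n + 1` of members of
two cross-intersecting families can be disjoint only if they are complementary. -/
theorem CrossIntersecting.link_inter_nonempty_or_eq_sdiff {n : ℕ} {𝒜 ℬ : Finset (Finset ℕ)}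
    (h : CrossIntersecting 𝒜 ℬ)
    (hshift : ∀ i, 1 ≤ i → i ≤ n → ∀ S ∈ 𝒜, n + 1 ∈ S → i ∉ S →
      insert i (S.erase (n + 1)) ∈ 𝒜)
    {A B : Finset ℕ} (hBn : B ⊆ Icc 1 n) (hA : A ∈ 𝒜.memberSubfamily (n + 1))
    (hB : B ∈ ℬ.memberSubfamily (n + 1)) : (A ∩ B).Nonempty ∨ B = Icc 1 n \ A := by
  rw [mem_memberSubfamily] at hA hB
  rw [or_iff_not_imp_left, not_nonempty_iff_eq_empty, ← disjoint_iff_inter_eq_empty]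
  intro hdisj
  refine Subset.antisymm (subset_sdiff.2 ⟨hBn, hdisj.symm⟩) fun i hi => ?_
  by_contra hiB
  rw [mem_sdiff, mem_Icc] at hi
  have hmem := hshift i hi.1.1 hi.1.2 _ hA.1 (mem_insert_self _ _) (by grind)
  rw [erase_insert hA.2] at hmem
  obtain ⟨x, hx⟩ := h _ hmem _ hB.1
  have hxB : x ∈ A → x ∉ B := fun hxA => disjoint_left.1 hdisj hxA
  grind

theorem CrossIntersecting.card_mul_card_le_starCard {n : ℕ} (hn : 1 ≤ n)
    {𝒜 𝒢 ℬ ℋ : Finset (Finset ℕ)} (h𝒜 : 𝒜 ⊆ 𝒢) (hℬ : ℬ ⊆ ℋ) (h𝒢 : IsCompressedComplex n 𝒢)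
    (hℋ : IsCompressedComplex n ℋ) (h : CrossIntersecting 𝒜 ℬ) :
    #𝒜 * #ℬ ≤ starCard 𝒢 * starCard ℋ := by
  induction n, hn using Nat.le_induction generalizing 𝒜 𝒢 ℬ ℋ with
  | base =>
    have hone : ∀ A B, A ⊆ Icc 1 1 → (A ∩ B).Nonempty → 1 ∈ A := by
      rintro A B hA ⟨x, hx⟩
      have := hA (mem_of_mem_inter_left hx)
      grind
    rcases 𝒜.eq_empty_or_nonempty with rfl | ⟨A₀, hA₀⟩
    · simp
    rcases ℬ.eq_empty_or_nonempty with rfl | ⟨B₀, hB₀⟩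
    · simp
    refine Nat.mul_le_mul (card_le_card fun A hA => ?_) (card_le_card fun B hB => ?_)
    · exact mem_filter.2 ⟨h𝒜 hA, hone A _ (h𝒢.subset_Icc A (h𝒜 hA)) (h A hA B₀ hB₀)⟩
    · exact mem_filter.2 ⟨hℬ hB, hone B _ (hℋ.subset_Icc B (hℬ hB)) (h.symm B hB A₀ hA₀)⟩
  | succ n hn ih =>
    induction hd : #{A ∈ 𝒜 | n + 1 ∈ A} using Nat.strong_induction_on generalizing 𝒜 ℬ with
    | _ d ihd =>
    by_cases hshift : ∀ i, 1 ≤ i → i ≤ n → ∀ S ∈ 𝒜, n + 1 ∈ S → i ∉ S →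
        insert i (S.erase (n + 1)) ∈ 𝒜
    swap
    · push Not at hshift
      obtain ⟨i, hi, hin, S, hS, hnS, hiS, hnot⟩ := hshift
      have hlt : i < n + 1 := by omega
      have := ihd _ (hd ▸ card_filter_compression_lt hlt.ne hS hnS hiS hnot)
        (h𝒢.compression_subset hi hlt h𝒜) (hℋ.compression_subset hi hlt hℬ)
        (h.compression hlt.ne) rfl
      rwa [UV.card_compression, UV.card_compression] at this
    rcases 𝒜.eq_empty_or_nonempty with rfl | ⟨A₀, hA₀⟩
    · simp
    rcases ℬ.eq_empty_or_nonempty with rfl | ⟨B₀, hB₀⟩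
    · simp
    have h𝒢1 : {1} ∈ 𝒢 :=
      h𝒢.singleton_one_mem (h𝒜 hA₀) ((h A₀ hA₀ B₀ hB₀).mono inter_subset_left)
    have hℋ1 : {1} ∈ ℋ :=
      hℋ.singleton_one_mem (hℬ hB₀) ((h A₀ hA₀ B₀ hB₀).mono inter_subset_right)
    have hA₀G : 𝒜.nonMemberSubfamily (n + 1) ⊆ 𝒢.nonMemberSubfamily (n + 1) :=
      filter_subset_filter _ h𝒜
    have hB₀H : ℬ.nonMemberSubfamily (n + 1) ⊆ ℋ.nonMemberSubfamily (n + 1) :=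
      filter_subset_filter _ hℬ
    have hA₁G : 𝒜.memberSubfamily (n + 1) ⊆ 𝒢.memberSubfamily (n + 1) :=
      image_subset_image (filter_subset_filter _ h𝒜)
    have hB₁H : ℬ.memberSubfamily (n + 1) ⊆ ℋ.memberSubfamily (n + 1) :=
      image_subset_image (filter_subset_filter _ hℬ)
    obtain ⟨k, hka, hkb, hk⟩ := exists_redistribution (X := Icc 1 n)
      (𝒜₀ := 𝒜.nonMemberSubfamily (n + 1)) (𝒜₁ := 𝒜.memberSubfamily (n + 1))
      (ℬ₀ := ℬ.nonMemberSubfamily (n + 1)) (ℬ₁ := ℬ.memberSubfamily (n + 1))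
      (fun A hA => mem_powerset.2 (h𝒢.memberSubfamily.subset_Icc A (hA₁G hA)))
      (fun A hA B hB => h A (mem_nonMemberSubfamily.1 hA).1 B (mem_nonMemberSubfamily.1 hB).1)
      (fun A hA B hB => by
        rw [mem_nonMemberSubfamily] at hA
        rw [mem_memberSubfamily] at hB
        rw [← inter_insert_of_notMem hA.2]
        exact h A hA.1 _ hB.1)
      (fun A hA B hB => by
        rw [mem_memberSubfamily] at hA
        rw [mem_nonMemberSubfamily] at hB
        rw [← insert_inter_of_notMem hB.2]
        exact h _ hA.1 B hB.1)
      (fun A hA B hB => h.link_inter_nonempty_or_eq_sdiff hshift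
        (hℋ.memberSubfamily.subset_Icc B (hB₁H hB)) hA hB)
    have hnum := mul_le_mul_or_eq_of_redistribute hka hkb
      (g₀ := starCard (𝒢.nonMemberSubfamily (n + 1))) (g₁ := starCard (𝒢.memberSubfamily (n + 1)))
      (h₀ := starCard (ℋ.nonMemberSubfamily (n + 1))) (h₁ := starCard (ℋ.memberSubfamily (n + 1)))
      (fun x y hxy => by
        obtain ⟨𝒜₀, hs𝒜₀, 𝒜₁, hs𝒜₁, ℬ₀, hsℬ₀, ℬ₁, hsℬ₁, ⟨e₁, e₂, e₃, e₄⟩, c₀₀, c₀₁, c₁₀, c₁₁⟩ :=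
          hk x y hxy
        rw [← e₁, ← e₂, ← e₃, ← e₄]
        have s₁ := hs𝒜₀.trans
          (union_subset hA₀G (hA₁G.trans (h𝒢.memberSubfamily_subset (n + 1))))
        have s₂ := hs𝒜₁.trans hA₁G
        have s₃ := hsℬ₀.trans
          (union_subset hB₀H (hB₁H.trans (hℋ.memberSubfamily_subset (n + 1))))
        have s₄ := hsℬ₁.trans hB₁H
        exact ⟨ih s₁ s₃ h𝒢.nonMemberSubfamily hℋ.nonMemberSubfamily c₀₀,
          ih s₁ s₄ h𝒢.nonMemberSubfamily hℋ.memberSubfamily c₀₁,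
          ih s₂ s₃ h𝒢.memberSubfamily hℋ.nonMemberSubfamily c₁₀,
          ih s₂ s₄ h𝒢.memberSubfamily hℋ.memberSubfamily c₁₁⟩)
    rcases hnum with hle | ⟨heqℋ, heq𝒢⟩
    · rwa [← starCard_split (by omega), ← starCard_split (by omega),
        add_comm, card_memberSubfamily_add_card_nonMemberSubfamily, add_comm,
        card_memberSubfamily_add_card_nonMemberSubfamily] at hle
    · have hpos : ∀ 𝒦 : Finset (Finset ℕ), {1} ∈ 𝒦 →
          0 < starCard (𝒦.nonMemberSubfamily (n + 1)) := fun 𝒦 h𝒦 =>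
        card_pos.2 ⟨{1}, by simp [h𝒦]; omega⟩
      have hG := h𝒢.eq_powerset hn h𝒢1 (Nat.eq_of_mul_eq_mul_right (hpos ℋ hℋ1) heq𝒢).symm
      have hH := hℋ.eq_powerset hn hℋ1 (Nat.eq_of_mul_eq_mul_left (hpos 𝒢 h𝒢1) heqℋ).symm
      have hsum := h.card_add_card_le (hG ▸ h𝒜) (hH ▸ hℬ)
      rw [Nat.card_Icc, Nat.add_sub_cancel, pow_succ] at hsum
      have hg := two_pow_le_starCard_powerset n
      rw [hG, hH]
      calc #𝒜 * #ℬ ≤ 2 ^ n * 2 ^ n := by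
            zify at hsum ⊢
            nlinarith [sq_nonneg ((#𝒜 : ℤ) - #ℬ)]
        _ ≤ _ := Nat.mul_le_mul hg hg

theorem isCompressedComplex_of_le {m n : ℕ} (hmn : m ≤ n) {𝒢 : Finset (Finset ℕ)}
    (h𝒢 : ∀ S ∈ 𝒢, S ⊆ Icc 1 m) (hher : ∀ S ∈ 𝒢, ∀ T ⊆ S, T ∈ 𝒢)
    (hcomp : ∀ i j, 1 ≤ i → i < j → j ≤ m →
      ∀ S ∈ 𝒢, j ∈ S → i ∉ S → insert i (S.erase j) ∈ 𝒢) :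
    IsCompressedComplex n 𝒢 where
  subset_Icc S hS := (h𝒢 S hS).trans (Icc_subset_Icc_right hmn)
  mem_of_subset := hher
  shift_mem i j hi hij S hS hj := hcomp i j hi hij (mem_Icc.1 (h𝒢 S hS hj)).2 S hS hj

/-- The main theorem: if `A ⊆ G ⊆ 2^{[m]}`, `B ⊆ H ⊆ 2^{[n]}`, `G` and `H` are
hereditary and compressed, and `A` and `B` are cross-intersecting, then
`|A|·|B| ≤ |G(1)|·|H(1)|`. -/
theorem cross_intersecting_hereditary_compressed_product_bound
    (m n : ℕ) (hm : 1 ≤ m) (hn : 1 ≤ n)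
    (𝒜 𝒢 ℬ ℋ : Finset (Finset ℕ))
    (h𝒜𝒢 : 𝒜 ⊆ 𝒢) (h𝒢 : ∀ S ∈ 𝒢, S ⊆ Finset.Icc 1 m)
    (hℬℋ : ℬ ⊆ ℋ) (hℋ : ∀ S ∈ ℋ, S ⊆ Finset.Icc 1 n)
    (h𝒢her : ∀ S ∈ 𝒢, ∀ T ⊆ S, T ∈ 𝒢)
    (hℋher : ∀ S ∈ ℋ, ∀ T ⊆ S, T ∈ ℋ)
    (h𝒢comp : ∀ i j, 1 ≤ i → i < j → j ≤ m →
      ∀ S ∈ 𝒢, j ∈ S → i ∉ S → insert i (S.erase j) ∈ 𝒢)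
    (hℋcomp : ∀ i j, 1 ≤ i → i < j → j ≤ n →
      ∀ S ∈ ℋ, j ∈ S → i ∉ S → insert i (S.erase j) ∈ ℋ)
    (hcross : ∀ A ∈ 𝒜, ∀ B ∈ ℬ, (A ∩ B).Nonempty) :
    𝒜.card * ℬ.card ≤
      (𝒢.filter (fun S => 1 ∈ S)).card * (ℋ.filter (fun S => 1 ∈ S)).card := by
  exact CrossIntersecting.card_mul_card_le_starCard (hm.trans (le_max_left m n)) h𝒜𝒢 hℬℋ
    (isCompressedComplex_of_le (le_max_left m n) h𝒢 h𝒢her h𝒢comp)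
    (isCompressedComplex_of_le (le_max_right m n) hℋ hℋher hℋcomp) hcross
end

section
/- If k ≥ 2, A_i ⊆ H_i ⊆ 2^{[n_i]} for each i ∈ [k], each H_i is hereditary and compressed, and A_1, ..., A_k are cross-intersecting, then ∏_{i=1}^k |A_i| ≤ ∏_{i=1}^k |H_i(1)|, with equality if A_i = H_i(1) for all i. -/
open Finset

namespace CrossIntersecting

/-- A hereditary and compressed family of subsets of `{1, …, n}`. -/
structure HerCompressed (n : ℕ) (H : Finset (Finset ℕ)) : Prop where
  ground : ∀ S ∈ H, S ⊆ Icc 1 n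
  her : ∀ S ∈ H, ∀ T ⊆ S, T ∈ H
  comp : ∀ a b : ℕ, 1 ≤ a → a < b → ∀ S ∈ H, b ∈ S → a ∉ S → insert a (S.erase b) ∈ H

/-- Every set of the first family meets every set of the second. -/
def Cross (A B : Finset (Finset ℕ)) : Prop := ∀ S ∈ A, ∀ T ∈ B, (S ∩ T).Nonempty

/-- The members of a family containing `1`. -/
abbrev star (H : Finset (Finset ℕ)) : Finset (Finset ℕ) := H.filter (fun S => 1 ∈ S)

lemma Cross.symm {A B : Finset (Finset ℕ)} (h : Cross A B) : Cross B A := fun S hS T hT => by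
  rw [inter_comm]; exact h T hT S hS

lemma HerCompressed.nonMemberSubfamily {n : ℕ} {H : Finset (Finset ℕ)}
    (h : HerCompressed (n + 1) H) : HerCompressed n (H.nonMemberSubfamily (n + 1)) where
  ground S hS x hx := by
    rw [mem_nonMemberSubfamily] at hS
    have h1 := mem_Icc.1 (h.ground S hS.1 hx)
    have : x ≠ n + 1 := fun e => hS.2 (e ▸ hx)
    exact mem_Icc.2 (by omega)
  her S hS T hT := by
    rw [mem_nonMemberSubfamily] at hS ⊢
    exact ⟨h.her S hS.1 T hT, fun hx => hS.2 (hT hx)⟩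
  comp a b ha hab S hS hb haS := by
    rw [mem_nonMemberSubfamily] at hS ⊢
    have hb' := mem_Icc.1 (h.ground S hS.1 hb)
    refine ⟨h.comp a b ha hab S hS.1 hb haS, fun hx => ?_⟩
    rcases mem_insert.1 hx with e | hx
    · omega
    · exact hS.2 (mem_of_mem_erase hx)

lemma HerCompressed.memberSubfamily {n : ℕ} {H : Finset (Finset ℕ)}
    (h : HerCompressed (n + 1) H) : HerCompressed n (H.memberSubfamily (n + 1)) where
  ground S hS x hx := by
    rw [mem_memberSubfamily] at hS
    have h1 := mem_Icc.1 (h.ground _ hS.1 (mem_insert_of_mem hx))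
    have : x ≠ n + 1 := fun e => hS.2 (e ▸ hx)
    exact mem_Icc.2 (by omega)
  her S hS T hT := by
    rw [mem_memberSubfamily] at hS ⊢
    exact ⟨h.her _ hS.1 _ (insert_subset_insert _ hT), fun hx => hS.2 (hT hx)⟩
  comp a b ha hab S hS hb haS := by
    rw [mem_memberSubfamily] at hS ⊢
    have hb' := mem_Icc.1 (h.ground _ hS.1 (mem_insert_of_mem hb))
    have hbn : b ≠ n + 1 := fun e => hS.2 (e ▸ hb)
    have key := h.comp a b ha hab _ hS.1 (mem_insert_of_mem hb) (by
      simp only [mem_insert, not_or]; exact ⟨by omega, haS⟩)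
    rw [erase_insert_of_ne (Ne.symm hbn), Finset.insert_comm] at key
    refine ⟨key, fun hx => ?_⟩
    rcases mem_insert.1 hx with e | hx
    · omega
    · exact hS.2 (mem_of_mem_erase hx)

lemma HerCompressed.singleton_one_mem {n : ℕ} {H : Finset (Finset ℕ)} (h : HerCompressed n H)
    {S : Finset ℕ} (hS : S ∈ H) (hne : S.Nonempty) : {1} ∈ H := by
  obtain ⟨x, hx⟩ := hne
  have h1 := mem_Icc.1 (h.ground S hS hx)
  have hx' : {x} ∈ H := h.her S hS _ (singleton_subset_iff.2 hx)
  rcases eq_or_lt_of_le h1.1 with e | hlt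
  · rwa [← e] at hx'
  · have := h.comp 1 x le_rfl hlt _ hx' (mem_singleton_self x) (by
      rw [mem_singleton]; omega)
    simpa using this

lemma memberSubfamily_subset_nonMemberSubfamily {n : ℕ} {H : Finset (Finset ℕ)}
    (h : HerCompressed (n + 1) H) :
    H.memberSubfamily (n + 1) ⊆ H.nonMemberSubfamily (n + 1) := fun S hS => by
  rw [mem_memberSubfamily] at hS
  exact mem_nonMemberSubfamily.2 ⟨h.her _ hS.1 _ (subset_insert _ _), hS.2⟩

lemma card_star_split {n : ℕ} (hn : 1 ≤ n) (H : Finset (Finset ℕ)) :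
    #(star H) = #(star (H.nonMemberSubfamily (n + 1))) +
      #(star (H.memberSubfamily (n + 1))) := by
  rw [← card_memberSubfamily_add_card_nonMemberSubfamily (n + 1) (star H), add_comm]
  congr 2
  · ext S; simp only [mem_nonMemberSubfamily, mem_filter]; tauto
  · ext S
    have : (1 : ℕ) ≠ n + 1 := by omega
    simp only [mem_memberSubfamily, mem_filter, mem_insert, this, false_or]; tauto

/-- If adding the last point never leads out of the star, then the star is a full one. -/
lemma star_eq_full {n : ℕ} (hn : 1 ≤ n) {H : Finset (Finset ℕ)}
    (h : HerCompressed (n + 1) H)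
    (hone : {1} ∈ H)
    (hcard : #(star (H.nonMemberSubfamily (n + 1))) ≤ #(star (H.memberSubfamily (n + 1)))) :
    star (H.nonMemberSubfamily (n + 1)) = star (Icc 1 n).powerset := by
  have heq : star (H.memberSubfamily (n + 1)) = star (H.nonMemberSubfamily (n + 1)) :=
    eq_of_subset_of_card_le
      (filter_subset_filter _ (memberSubfamily_subset_nonMemberSubfamily h)) hcard
  have key : ∀ S : Finset ℕ, S ⊆ Icc 1 n → insert 1 S ∈ H := by
    intro S
    induction S using Finset.induction_on with
    | empty => intro _; simpa using hone
    | insert c S hc ih =>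
      intro hS
      have hcn := mem_Icc.1 (hS (mem_insert_self c S))
      have hSn : S ⊆ Icc 1 n := (subset_insert c S).trans hS
      have ih' := ih hSn
      by_cases hc1 : c = 1
      · subst hc1; simpa using ih'
      have hnot : n + 1 ∉ insert 1 S := by
        intro hx
        rcases mem_insert.1 hx with e | hx
        · omega
        · have := mem_Icc.1 (hSn hx); omega
      have hmem : insert 1 S ∈ star (H.memberSubfamily (n + 1)) := by
        rw [heq, mem_filter, mem_nonMemberSubfamily]
        exact ⟨⟨ih', hnot⟩, mem_insert_self _ _⟩
      have hmem' := (mem_memberSubfamily.1 (mem_filter.1 hmem).1).1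
      have := h.comp c (n + 1) hcn.1 (by omega) _ hmem' (mem_insert_self _ _) (by
        simp only [mem_insert, not_or]; exact ⟨by omega, hc1, hc⟩)
      rwa [erase_insert hnot, Finset.insert_comm] at this
  ext S
  simp only [mem_filter, mem_powerset]
  constructor
  · rintro ⟨hS, h1⟩
    exact ⟨h.nonMemberSubfamily.ground S hS, h1⟩
  · rintro ⟨hS, h1⟩
    refine ⟨mem_nonMemberSubfamily.2 ⟨?_, fun hx => ?_⟩, h1⟩
    · simpa [insert_eq_of_mem h1] using key S hS
    · have := mem_Icc.1 (hS hx); omega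

/-! ### Shifting -/

lemma compress_eq {c m : ℕ} {S : Finset ℕ} (hm : m ∈ S) (hc : c ∉ S) :
    UV.compress {c} {m} S = insert c (S.erase m) := by
  have hcm : c ≠ m := fun e => hc (e ▸ hm)
  rw [UV.compress, if_pos ⟨by simpa using hc, by simpa using hm⟩]
  ext x
  simp only [sup_eq_union, mem_sdiff, mem_union, mem_singleton, mem_insert, mem_erase]
  constructor
  · tauto
  · rintro (e | h)
    · exact ⟨Or.inr e, e ▸ hcm⟩
    · tauto

lemma compress_eq_self {c m : ℕ} {S : Finset ℕ} (h : ¬ (m ∈ S ∧ c ∉ S)) :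
    UV.compress {c} {m} S = S := by
  rw [UV.compress, if_neg]
  simpa using fun h1 h2 => h ⟨h2, h1⟩

lemma mem_shift {c m : ℕ} {A : Finset (Finset ℕ)} {S : Finset ℕ}
    (hS : S ∈ UV.compression {c} {m} A) :
    (S ∈ A ∧ (m ∈ S → c ∉ S → insert c (S.erase m) ∈ A)) ∨
      ∃ T ∈ A, m ∈ T ∧ c ∉ T ∧ S = insert c (T.erase m) := by
  rcases UV.mem_compression.1 hS with ⟨h1, h2⟩ | ⟨h1, T, hT, rfl⟩
  · exact Or.inl ⟨h1, fun hm hc => compress_eq hm hc ▸ h2⟩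
  · by_cases h : m ∈ T ∧ c ∉ T
    · exact Or.inr ⟨T, hT, h.1, h.2, compress_eq h.1 h.2⟩
    · rw [compress_eq_self h] at h1; exact absurd hT h1

lemma shift_subset {n c m : ℕ} {A H : Finset (Finset ℕ)} (h : HerCompressed n H)
    (hc : 1 ≤ c) (hcm : c < m) (hA : A ⊆ H) : UV.compression {c} {m} A ⊆ H := by
  intro S hS
  rcases mem_shift hS with h1 | ⟨T, hT, hm, hcT, rfl⟩
  · exact hA h1.1
  · exact h.comp c m hc hcm T (hA hT) hm hcT

lemma inter_shift_nonempty {c m : ℕ} {A B : Finset (Finset ℕ)} (h : Cross A B)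
    {S T : Finset ℕ} (hS : S ∈ A) (hcS : c ∉ S) (hT : T ∈ B)
    (hT' : m ∈ T → c ∉ T → insert c (T.erase m) ∈ B) :
    (insert c (S.erase m) ∩ T).Nonempty := by
  by_cases hcT : c ∈ T
  · exact ⟨c, by simp [hcT]⟩
  by_cases hmT : m ∈ T
  · obtain ⟨x, hx⟩ := h S hS _ (hT' hmT hcT)
    refine ⟨x, ?_⟩
    simp only [mem_inter, mem_insert, mem_erase] at hx ⊢
    have : x ≠ c := fun e => hcS (e ▸ hx.1)
    tauto
  · obtain ⟨x, hx⟩ := h S hS T hT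
    refine ⟨x, ?_⟩
    simp only [mem_inter, mem_insert, mem_erase] at hx ⊢
    have : x ≠ m := fun e => hmT (e ▸ hx.2)
    tauto

lemma Cross.shift {c m : ℕ} {A B : Finset (Finset ℕ)} (h : Cross A B) :
    Cross (UV.compression {c} {m} A) (UV.compression {c} {m} B) := by
  intro S hS T hT
  rcases mem_shift hS with ⟨hS₀, hS'⟩ | ⟨S, hS₀, _, hcS, rfl⟩ <;>
    rcases mem_shift hT with ⟨hT₀, hT'⟩ | ⟨T, hT₀, _, hcT, rfl⟩
  · exact h S hS₀ T hT₀
  · rw [inter_comm]; exact inter_shift_nonempty h.symm hT₀ hcT hS₀ hS'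
  · exact inter_shift_nonempty h hS₀ hcS hT₀ hT'
  · exact ⟨c, by simp⟩

lemma shift_filter_subset {c m : ℕ} (hcm : c < m) (A : Finset (Finset ℕ)) :
    (UV.compression {c} {m} A).filter (m ∈ ·) ⊆ A.filter (m ∈ ·) := by
  intro S hS
  rw [mem_filter] at hS ⊢
  rcases mem_shift hS.1 with h1 | ⟨T, hT, hm, hcT, rfl⟩
  · exact ⟨h1.1, hS.2⟩
  · have := hS.2
    simp only [mem_insert, mem_erase] at this
    omega

lemma shift_filter_ssubset {c m : ℕ} (hcm : c < m) {A : Finset (Finset ℕ)} {S : Finset ℕ}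
    (hS : S ∈ A) (hm : m ∈ S) (hc : c ∉ S) (hn : insert c (S.erase m) ∉ A) :
    (UV.compression {c} {m} A).filter (m ∈ ·) ⊂ A.filter (m ∈ ·) := by
  refine (ssubset_iff_of_subset (shift_filter_subset hcm A)).2
    ⟨S, mem_filter.2 ⟨hS, hm⟩, fun h => ?_⟩
  rcases mem_shift (mem_filter.1 h).1 with h1 | ⟨T, _, _, _, rfl⟩
  · exact hn (h1.2 hm hc)
  · exact hc (mem_insert_self _ _)

/-- Cross-intersecting families can be replaced by families of the same sizes of which the first
is stable under the shifts that replace the last point. -/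
lemma exists_shifted {m : ℕ} {G H : Finset (Finset ℕ)} (hG : HerCompressed m G)
    (hH : HerCompressed m H) (A B : Finset (Finset ℕ)) (hA : A ⊆ G) (hB : B ⊆ H)
    (hAB : Cross A B) :
    ∃ A' ⊆ G, ∃ B' ⊆ H, Cross A' B' ∧ #A' = #A ∧ #B' = #B ∧
      ∀ c, 1 ≤ c → c < m → ∀ S ∈ A', m ∈ S → c ∉ S → insert c (S.erase m) ∈ A' := by
  induction hk : #(A.filter (m ∈ ·)) using Nat.strong_induction_on generalizing A B with
  | _ k ih =>
    subst hk
    by_cases hst : ∀ c, 1 ≤ c → c < m → ∀ S ∈ A, m ∈ S → c ∉ S → insert c (S.erase m) ∈ A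
    · exact ⟨A, hA, B, hB, hAB, rfl, rfl, hst⟩
    push Not at hst
    obtain ⟨c, hc, hcm, S, hS, hmS, hcS, hnS⟩ := hst
    obtain ⟨A', hA', B', hB', hcr, h1, h2, h3⟩ :=
      ih _ (card_lt_card (shift_filter_ssubset hcm hS hmS hcS hnS)) _
        (UV.compression {c} {m} B) (shift_subset hG hc hcm hA) (shift_subset hH hc hcm hB)
        hAB.shift rfl
    refine ⟨A', hA', B', hB', hcr, ?_, ?_, h3⟩
    · rw [h1, UV.card_compression]
    · rw [h2, UV.card_compression]

/-! ### The induction step -/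

lemma mul_bound_arith_balanced {x y u v g₀ g₁ h₀ h₁ : ℕ} (hsum : x + y = u + v)
    (e1 : (x + 1) * u ≤ g₀ * h₀) (e2 : (x + 1) * v ≤ g₀ * h₁)
    (e3 : (y + 1) * u ≤ g₁ * h₀) (e4 : (y + 1) * v ≤ g₁ * h₁)
    (f1 : x * (u + 1) ≤ g₀ * h₀) (f2 : x * (v + 1) ≤ g₀ * h₁)
    (f3 : y * (u + 1) ≤ g₁ * h₀) (f4 : y * (v + 1) ≤ g₁ * h₁)
    (hg : g₁ ≤ g₀) (hh : h₁ ≤ h₀) (hg₀ : 0 < g₀) (hh₀ : 0 < h₀)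
    (hfull : g₀ ≤ g₁ → h₀ ≤ h₁ → g₀ = h₀) :
    (x + y + 1) * (u + v + 1) ≤ (g₀ + g₁) * (h₀ + h₁) := by
  by_contra! hcon
  have c1 : (x + 1) * u = g₀ * h₀ := le_antisymm e1 (by linarith)
  have c2 : (x + 1) * v = g₀ * h₁ := le_antisymm e2 (by linarith)
  have c4 : (y + 1) * v = g₁ * h₁ := le_antisymm e4 (by linarith)
  have d1 : x * (u + 1) = g₀ * h₀ := le_antisymm f1 (by linarith)
  have d2 : x * (v + 1) = g₀ * h₁ := le_antisymm f2 (by linarith)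
  obtain rfl : x = u := by linarith
  obtain rfl : x = v := by linarith
  obtain rfl : x = y := by omega
  have heq : g₀ * h₀ = g₁ * h₁ := c1.symm.trans c4
  have hgg : g₀ ≤ g₁ := by
    by_contra! hlt
    have := Nat.mul_lt_mul_of_lt_of_le hlt hh hh₀
    omega
  have hhh : h₀ ≤ h₁ := by
    by_contra! hlt
    have := Nat.mul_lt_mul_of_le_of_lt hg hlt hg₀
    omega
  obtain rfl := hfull hgg hhh
  have hlt : x < g₀ := by
    by_contra! hle
    have := Nat.mul_le_mul hle hle
    have : 0 < x := hg₀.trans_le hle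
    linarith
  have := Nat.mul_le_mul hlt hlt
  simp only [Nat.succ_eq_add_one] at this
  linarith

lemma mul_bound_arith {a₀ a₁ b₀ b₁ g₀ g₁ h₀ h₁ p : ℕ}
    (hbound : ∀ q s, q + s = p →
      (a₀ + q) * (b₀ + s) ≤ g₀ * h₀ ∧ (a₀ + q) * (b₁ + s) ≤ g₀ * h₁ ∧
      (a₁ + q) * (b₀ + s) ≤ g₁ * h₀ ∧ (a₁ + q) * (b₁ + s) ≤ g₁ * h₁)
    (hg : g₁ ≤ g₀) (hh : h₁ ≤ h₀) (hg₀ : 0 < g₀) (hh₀ : 0 < h₀)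
    (hfull : g₀ ≤ g₁ → h₀ ≤ h₁ → g₀ = h₀) :
    (a₀ + (a₁ + p)) * (b₀ + (b₁ + p)) ≤ (g₀ + g₁) * (h₀ + h₁) := by
  rcases Nat.even_or_odd' p with ⟨r, rfl | rfl⟩
  · obtain ⟨e1, e2, e3, e4⟩ := hbound r r (by ring)
    nlinarith
  · obtain ⟨e1, e2, e3, e4⟩ := hbound (r + 1) r (by ring)
    obtain ⟨f1, f2, f3, f4⟩ := hbound r (r + 1) (by ring)
    rcases lt_trichotomy (a₀ + a₁) (b₀ + b₁) with hlt | heq | hgt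
    · nlinarith
    · have hS : a₀ + r + (a₁ + r) = b₀ + r + (b₁ + r) := by omega
      calc (a₀ + (a₁ + (2 * r + 1))) * (b₀ + (b₁ + (2 * r + 1)))
          = (a₀ + r + (a₁ + r) + 1) * (b₀ + r + (b₁ + r) + 1) := by ring
        _ ≤ _ := mul_bound_arith_balanced hS e1 e2 e3 e4 f1 f2 f3 f4 hg hh hg₀ hh₀ hfull
    · nlinarith

lemma step_bounds {n : ℕ} {A B G H : Finset (Finset ℕ)}
    (ih : ∀ {A B G H : Finset (Finset ℕ)}, HerCompressed n G → HerCompressed n H →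
      A ⊆ G → B ⊆ H → Cross A B → #A * #B ≤ #(star G) * #(star H))
    (hG : HerCompressed (n + 1) G) (hH : HerCompressed (n + 1) H) (hA : A ⊆ G) (hB : B ⊆ H)
    (hAB : Cross A B)
    (hshift : ∀ c, 1 ≤ c → c < n + 1 → ∀ S ∈ A, n + 1 ∈ S → c ∉ S →
      insert c (S.erase (n + 1)) ∈ A) :
    ∃ p a₁ b₁, #(A.memberSubfamily (n + 1)) = a₁ + p ∧ #(B.memberSubfamily (n + 1)) = b₁ + p ∧
      ∀ q s, q + s = p →
      (#(A.nonMemberSubfamily (n + 1)) + q) * (#(B.nonMemberSubfamily (n + 1)) + s) ≤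
        #(star (G.nonMemberSubfamily (n + 1))) * #(star (H.nonMemberSubfamily (n + 1))) ∧
      (#(A.nonMemberSubfamily (n + 1)) + q) * (b₁ + s) ≤
        #(star (G.nonMemberSubfamily (n + 1))) * #(star (H.memberSubfamily (n + 1))) ∧
      (a₁ + q) * (#(B.nonMemberSubfamily (n + 1)) + s) ≤
        #(star (G.memberSubfamily (n + 1))) * #(star (H.nonMemberSubfamily (n + 1))) ∧
      (a₁ + q) * (b₁ + s) ≤
        #(star (G.memberSubfamily (n + 1))) * #(star (H.memberSubfamily (n + 1))) := by
  have hG0 := hG.nonMemberSubfamily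
  have hG1 := hG.memberSubfamily
  have hH0 := hH.nonMemberSubfamily
  have hH1 := hH.memberSubfamily
  have hG10 := memberSubfamily_subset_nonMemberSubfamily hG
  have hH10 := memberSubfamily_subset_nonMemberSubfamily hH
  have hA0G : A.nonMemberSubfamily (n + 1) ⊆ G.nonMemberSubfamily (n + 1) := fun S hS => by
    rw [mem_nonMemberSubfamily] at hS ⊢; exact ⟨hA hS.1, hS.2⟩
  have hA1G : A.memberSubfamily (n + 1) ⊆ G.memberSubfamily (n + 1) := fun S hS => by
    rw [mem_memberSubfamily] at hS ⊢; exact ⟨hA hS.1, hS.2⟩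
  have hB0H : B.nonMemberSubfamily (n + 1) ⊆ H.nonMemberSubfamily (n + 1) := fun S hS => by
    rw [mem_nonMemberSubfamily] at hS ⊢; exact ⟨hB hS.1, hS.2⟩
  have hB1H : B.memberSubfamily (n + 1) ⊆ H.memberSubfamily (n + 1) := fun S hS => by
    rw [mem_memberSubfamily] at hS ⊢; exact ⟨hB hS.1, hS.2⟩
  have c00 : Cross (A.nonMemberSubfamily (n + 1)) (B.nonMemberSubfamily (n + 1)) :=
    fun S hS T hT => hAB S (mem_nonMemberSubfamily.1 hS).1 T (mem_nonMemberSubfamily.1 hT).1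
  have c01 : Cross (A.nonMemberSubfamily (n + 1)) (B.memberSubfamily (n + 1)) := by
    intro S hS T hT
    rw [mem_nonMemberSubfamily] at hS
    have := hAB S hS.1 _ (mem_memberSubfamily.1 hT).1
    rwa [inter_insert_of_notMem hS.2] at this
  have c10 : Cross (A.memberSubfamily (n + 1)) (B.nonMemberSubfamily (n + 1)) := by
    intro S hS T hT
    rw [mem_nonMemberSubfamily] at hT
    have := hAB _ (mem_memberSubfamily.1 hS).1 T hT.1
    rwa [insert_inter_of_notMem hT.2] at this
  have c11 : ∀ S ∈ A.memberSubfamily (n + 1), ∀ T ∈ B.memberSubfamily (n + 1),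
      T ≠ Icc 1 n \ S → (S ∩ T).Nonempty := by
    intro S hS T hT hne
    by_contra hemp
    rw [not_nonempty_iff_eq_empty, ← disjoint_iff_inter_eq_empty] at hemp
    apply hne
    have hTg := hH1.ground T (hB1H hT)
    refine subset_antisymm (subset_sdiff.2 ⟨hTg, hemp.symm⟩) fun c hc => ?_
    rw [mem_sdiff, mem_Icc] at hc
    by_contra hcT
    rw [mem_memberSubfamily] at hS hT
    have h1 := hshift c hc.1.1 (by omega) _ hS.1 (mem_insert_self _ _) (by
      simp only [mem_insert, not_or]; exact ⟨by omega, hc.2⟩)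
    rw [erase_insert hS.2] at h1
    obtain ⟨x, hx⟩ := hAB _ h1 _ hT.1
    simp only [mem_inter, mem_insert] at hx
    rcases hx with ⟨rfl | hxS, rfl | hxT⟩
    · omega
    · exact hcT hxT
    · exact hS.2 hxS
    · exact disjoint_left.1 hemp hxS hxT
  generalize A.nonMemberSubfamily (n + 1) = A0 at *
  generalize A.memberSubfamily (n + 1) = A1 at *
  generalize B.nonMemberSubfamily (n + 1) = B0 at *
  generalize B.memberSubfamily (n + 1) = B1 at *
  set P := A1.filter (fun S => Icc 1 n \ S ∈ B1)
  have hPA1 : P ⊆ A1 := filter_subset _ _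
  have hinj : Set.InjOn (fun S => Icc 1 n \ S) (P : Set (Finset ℕ)) := by
    intro S hS T hT hST
    have hS' := hG1.ground S (hA1G (hPA1 hS))
    have hT' := hG1.ground T (hA1G (hPA1 hT))
    simp only at hST
    rw [← Finset.sdiff_sdiff_eq_self hS', hST, Finset.sdiff_sdiff_eq_self hT']
  have hcardP : ∀ Q ⊆ P, #(Q.image fun S => Icc 1 n \ S) = #Q := fun Q hQ =>
    card_image_of_injOn (hinj.mono (by exact_mod_cast hQ))
  have himB : ∀ Q ⊆ P, (Q.image fun S => Icc 1 n \ S) ⊆ B1 := by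
    intro Q hQ T hT
    obtain ⟨S, hS, rfl⟩ := mem_image.1 hT
    exact (mem_filter.1 (hQ hS)).2
  have hdA : Disjoint A0 P := by
    rw [disjoint_left]
    intro S hS hSP
    obtain ⟨x, hx⟩ := c01 S hS _ (mem_filter.1 hSP).2
    simp only [mem_inter, mem_sdiff] at hx
    exact hx.2.2 hx.1
  have hdB : Disjoint B0 (P.image fun S => Icc 1 n \ S) := by
    rw [disjoint_left]
    intro T hT hTP
    obtain ⟨S, hS, rfl⟩ := mem_image.1 hTP
    obtain ⟨x, hx⟩ := c10 S (hPA1 hS) _ hT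
    simp only [mem_inter, mem_sdiff] at hx
    exact hx.2.2 hx.1
  have hpa : #P ≤ #A1 := card_le_card hPA1
  have hpb : #P ≤ #B1 := hcardP P subset_rfl ▸ card_le_card (himB P subset_rfl)
  refine ⟨#P, #A1 - #P, #B1 - #P, by omega, by omega, fun q s hqs => ?_⟩
  obtain ⟨Q, hQP, hQ⟩ := exists_subset_card_eq (show q ≤ #P by omega)
  have hRP : P \ Q ⊆ P := sdiff_subset
  have hR : #(P \ Q) = s := by rw [card_sdiff_of_subset hQP]; omega
  have e1 : #(A0 ∪ Q) = #A0 + q := by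
    rw [card_union_of_disjoint (hdA.mono_right hQP), hQ]
  have e2 : #(B0 ∪ (P \ Q).image fun S => Icc 1 n \ S) = #B0 + s := by
    rw [card_union_of_disjoint (hdB.mono_right (image_subset_image hRP)), hcardP _ hRP, hR]
  have e3 : #(A1 \ (P \ Q)) = #A1 - #P + q := by
    rw [card_sdiff_of_subset (hRP.trans hPA1), hR]; omega
  have e4 : #(B1 \ Q.image fun S => Icc 1 n \ S) = #B1 - #P + s := by
    rw [card_sdiff_of_subset (himB Q hQP), hcardP Q hQP, hQ]; omega
  rw [← e1, ← e2, ← e3, ← e4]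
  have sA0 : A0 ∪ Q ⊆ G.nonMemberSubfamily (n + 1) :=
    union_subset hA0G (hQP.trans (hPA1.trans (hA1G.trans hG10)))
  have sA1 : A1 \ (P \ Q) ⊆ G.memberSubfamily (n + 1) := sdiff_subset.trans hA1G
  have sB0 : (B0 ∪ (P \ Q).image fun S => Icc 1 n \ S) ⊆ H.nonMemberSubfamily (n + 1) :=
    union_subset hB0H ((himB _ hRP).trans (hB1H.trans hH10))
  have sB1 : (B1 \ Q.image fun S => Icc 1 n \ S) ⊆ H.memberSubfamily (n + 1) :=
    sdiff_subset.trans hB1H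
  refine ⟨ih hG0 hH0 sA0 sB0 ?_, ih hG0 hH1 sA0 sB1 ?_, ih hG1 hH0 sA1 sB0 ?_,
    ih hG1 hH1 sA1 sB1 ?_⟩
  · intro S hS T hT
    rcases mem_union.1 hS with hS | hS <;> rcases mem_union.1 hT with hT | hT
    · exact c00 S hS T hT
    · exact c01 S hS T (himB _ hRP hT)
    · exact c10 S (hPA1 (hQP hS)) T hT
    · refine c11 S (hPA1 (hQP hS)) T (himB _ hRP hT) ?_
      rintro rfl
      obtain ⟨S', hS', he⟩ := mem_image.1 hT
      have := hinj (hRP hS') (hQP hS) he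
      exact (mem_sdiff.1 hS').2 (this ▸ hS)
  · intro S hS T hT
    rw [mem_sdiff] at hT
    rcases mem_union.1 hS with hS | hS
    · exact c01 S hS T hT.1
    · refine c11 S (hPA1 (hQP hS)) T hT.1 ?_
      rintro rfl
      exact hT.2 (mem_image_of_mem _ hS)
  · intro S hS T hT
    rw [mem_sdiff] at hS
    rcases mem_union.1 hT with hT | hT
    · exact c10 S hS.1 T hT
    · refine c11 S hS.1 T (himB _ hRP hT) ?_
      rintro rfl
      obtain ⟨S', hS', he⟩ := mem_image.1 hT
      have hSP : S ∈ P := mem_filter.2 ⟨hS.1, himB _ hRP hT⟩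
      have := hinj (hRP hS') hSP he
      exact hS.2 (this ▸ hS')
  · intro S hS T hT
    rw [mem_sdiff] at hS hT
    refine c11 S hS.1 T hT.1 ?_
    rintro rfl
    have hSP : S ∈ P := mem_filter.2 ⟨hS.1, hT.1⟩
    by_cases hSQ : S ∈ Q
    · exact hT.2 (mem_image_of_mem _ hSQ)
    · exact hS.2 (mem_sdiff.2 ⟨hSP, hSQ⟩)

/-- The case of two families. -/
theorem card_mul_card_le {n : ℕ} {A B G H : Finset (Finset ℕ)} (hG : HerCompressed n G)
    (hH : HerCompressed n H) (hA : A ⊆ G) (hB : B ⊆ H) (hAB : Cross A B) :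
    #A * #B ≤ #(star G) * #(star H) := by
  induction n generalizing A B G H with
  | zero =>
    rcases A.eq_empty_or_nonempty with rfl | ⟨S, hS⟩
    · simp
    rcases B.eq_empty_or_nonempty with rfl | ⟨T, hT⟩
    · simp
    obtain ⟨x, hx⟩ := hAB S hS T hT
    have := mem_Icc.1 (hG.ground S (hA hS) (mem_inter.1 hx).1)
    omega
  | succ n ih =>
    rcases A.eq_empty_or_nonempty with rfl | ⟨S, hS⟩
    · simp
    rcases B.eq_empty_or_nonempty with rfl | ⟨T, hT⟩
    · simp
    rcases Nat.eq_zero_or_pos n with rfl | hn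
    · refine Nat.mul_le_mul (card_le_card fun S' hS' => ?_) (card_le_card fun T' hT' => ?_)
      · obtain ⟨x, hx⟩ := hAB S' hS' T hT
        have hxS := (mem_inter.1 hx).1
        have := mem_Icc.1 (hG.ground S' (hA hS') hxS)
        obtain rfl : x = 1 := by omega
        exact mem_filter.2 ⟨hA hS', hxS⟩
      · obtain ⟨x, hx⟩ := hAB S hS T' hT'
        have hxT := (mem_inter.1 hx).2
        have := mem_Icc.1 (hH.ground T' (hB hT') hxT)
        obtain rfl : x = 1 := by omega
        exact mem_filter.2 ⟨hB hT', hxT⟩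
    have hST := hAB S hS T hT
    have hG1 := hG.singleton_one_mem (hA hS) (hST.mono inter_subset_left)
    have hH1 := hH.singleton_one_mem (hB hT) (hST.mono inter_subset_right)
    have hpos : ∀ {F : Finset (Finset ℕ)}, {1} ∈ F →
        0 < #(star (F.nonMemberSubfamily (n + 1))) := fun {F} hF =>
      card_pos.2 ⟨{1}, mem_filter.2 ⟨mem_nonMemberSubfamily.2
        ⟨hF, by rw [mem_singleton]; omega⟩, mem_singleton_self 1⟩⟩
    obtain ⟨A', hA', B', hB', hcr, h1, h2, h3⟩ := exists_shifted hG hH A B hA hB hAB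
    obtain ⟨p, a₁, b₁, ha, hb, hbound⟩ := step_bounds ih hG hH hA' hB' hcr h3
    rw [← h1, ← h2, ← card_memberSubfamily_add_card_nonMemberSubfamily (n + 1) A',
      ← card_memberSubfamily_add_card_nonMemberSubfamily (n + 1) B', card_star_split hn G,
      card_star_split hn H, ha, hb, add_comm (a₁ + p), add_comm (b₁ + p)]
    refine mul_bound_arith hbound
      (card_le_card (filter_subset_filter _ (memberSubfamily_subset_nonMemberSubfamily hG)))
      (card_le_card (filter_subset_filter _ (memberSubfamily_subset_nonMemberSubfamily hH)))
      (hpos hG1) (hpos hH1) fun hg hh => ?_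
    rw [star_eq_full hn hG hG1 hg, star_eq_full hn hH hH1 hh]

/-- A pairwise bound on products of two factors gives a bound on the whole product. -/
lemma prod_le_prod_of_pairwise {ι : Type*} [Fintype ι] [DecidableEq ι] [Nontrivial ι]
    {a g : ι → ℕ} (h : ∀ i j, i ≠ j → a i * a j ≤ g i * g j) : ∏ i, a i ≤ ∏ i, g i := by
  by_cases hle : ∀ i, a i ≤ g i
  · exact prod_le_prod' fun i _ => hle i
  push Not at hle
  obtain ⟨i, hi⟩ := hle
  have hothers : ∀ j, j ≠ i → a j ≤ g j := fun j hj => by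
    by_contra! hlt
    exact absurd (h i j hj.symm) (not_le.2 (Nat.mul_lt_mul'' hi hlt))
  obtain ⟨j, hj⟩ := exists_ne i
  have hmem : j ∈ univ.erase i := mem_erase.2 ⟨hj, mem_univ j⟩
  rw [← mul_prod_erase univ a (mem_univ i), ← mul_prod_erase univ g (mem_univ i),
    ← mul_prod_erase _ a hmem, ← mul_prod_erase _ g hmem, ← mul_assoc, ← mul_assoc]
  exact Nat.mul_le_mul (h i j hj.symm) (prod_le_prod' fun l hl =>
    hothers l (mem_erase.1 (mem_erase.1 hl).2).1)

end CrossIntersecting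

/-- The `k`-family version of the main theorem for hereditary compressed families,
with equality attained by the stars at 1. -/
theorem cross_intersecting_k_hereditary_compressed_product_bound
    (k : ℕ) (hk : 2 ≤ k) (n : Fin k → ℕ)
    (𝒜 ℋ : Fin k → Finset (Finset ℕ))
    (hsub : ∀ i, 𝒜 i ⊆ ℋ i)
    (hground : ∀ i, ∀ S ∈ ℋ i, S ⊆ Finset.Icc 1 (n i))
    (hher : ∀ i, ∀ S ∈ ℋ i, ∀ T ⊆ S, T ∈ ℋ i)
    (hcomp : ∀ i, ∀ a b : ℕ, 1 ≤ a → a < b → b ≤ n i →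
      ∀ S ∈ ℋ i, b ∈ S → a ∉ S → insert a (S.erase b) ∈ ℋ i)
    (hcross : ∀ i j, i ≠ j → ∀ A ∈ 𝒜 i, ∀ B ∈ 𝒜 j, (A ∩ B).Nonempty) :
    (∏ i, (𝒜 i).card ≤ ∏ i, ((ℋ i).filter (fun S => 1 ∈ S)).card) ∧
      ((∀ i, 𝒜 i = (ℋ i).filter (fun S => 1 ∈ S)) →
        ∏ i, (𝒜 i).card = ∏ i, ((ℋ i).filter (fun S => 1 ∈ S)).card) := by
  refine ⟨?_, fun h => prod_congr rfl fun i _ => by rw [h i]⟩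
  have : Nontrivial (Fin k) := Fin.nontrivial_iff_two_le.2 hk
  have hle : ∀ i, n i ≤ univ.sup n := fun i => le_sup (mem_univ i)
  have hH : ∀ i, CrossIntersecting.HerCompressed (univ.sup n) (ℋ i) := fun i =>
    { ground := fun S hS => (hground i S hS).trans (Icc_subset_Icc_right (hle i))
      her := hher i
      comp := fun a b ha hab S hS hb haS =>
        hcomp i a b ha hab (mem_Icc.1 (hground i S hS hb)).2 S hS hb haS }
  exact CrossIntersecting.prod_le_prod_of_pairwise fun i j hij =>
    CrossIntersecting.card_mul_card_le (hH i) (hH j) (hsub i) (hsub j) (hcross i j hij)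
end
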